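/- arXiv:2306.17401 — 2 statements merged into one kernel-verified Lean document; each statement's English description precedes it below -/
import Mathlib

section
/- For every integer n ≥ 4, the minimum over k ∈ {2, 3, …, n−2} of the rational number (C(n−2, k−2) + C(n−2, k)) / (2*C(n−2, k−1)) equals (⌈n/2⌉ − 1) / ⌈n/2⌉. -/
/-- Binomial coefficient `C(a, b)` for integer lower index, with `C(a,b) = 0` for `b < 0`. -/
def C (a : ℕ) (b : ℤ) : ℕ := if b < 0 then 0 else a.choose b.toNat

theorem adjacent_choose_ratio (a b : ℕ) :
    (((a + b + 1).choose a + (a + b + 1).choose (a + 2) : ℕ) : ℚ) /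
        ((2 * (a + b + 1).choose (a + 1) : ℕ) : ℚ)
      = ((a : ℚ) + b + 3) * (a + b + 2) / (2 * (a + 2) * (b + 1)) - 1 := by
  have h₁ := Nat.choose_succ_right_eq (a + b + 1) a
  have h₂ := Nat.choose_succ_right_eq (a + b + 1) (a + 1)
  rw [show a + b + 1 - a = b + 1 by omega] at h₁
  rw [show a + b + 1 - (a + 1) = b by omega] at h₂
  have hq : 0 < (a + b + 1).choose (a + 1) := Nat.choose_pos (by omega)
  generalize (a + b + 1).choose a = p at *
  generalize (a + b + 1).choose (a + 1) = q at *
  generalize (a + b + 1).choose (a + 2) = r at *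
  have hp : (p : ℚ) = q * (a + 1) / (b + 1) := by
    rw [eq_div_iff (by positivity)]
    exact_mod_cast h₁.symm
  have hr : (r : ℚ) = q * b / (a + 2) := by
    rw [eq_div_iff (by positivity)]
    exact_mod_cast h₂
  have hq' : (q : ℚ) ≠ 0 := by positivity
  push_cast
  rw [hp, hr]
  field_simp
  ring

theorem C_ratio_eq {n k : ℕ} (hk : 2 ≤ k) (hkn : k < n) :
    ((C (n - 2) ((k : ℤ) - 2) + C (n - 2) (k : ℤ) : ℕ) : ℚ) /
        ((2 * C (n - 2) ((k : ℤ) - 1) : ℕ) : ℚ)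
      = (n : ℚ) * (n - 1) / (2 * k * (n - k)) - 1 := by
  obtain ⟨a, rfl⟩ := Nat.exists_eq_add_of_le' hk
  obtain ⟨b, rfl⟩ := Nat.exists_eq_add_of_lt hkn
  have h₀ : C (a + b + 1) (((a + 2 : ℕ) : ℤ) - 2) = (a + b + 1).choose a := by
    rw [C, if_neg (by omega)]; congr 1; omega
  have h₁ : C (a + b + 1) (((a + 2 : ℕ) : ℤ) - 1) = (a + b + 1).choose (a + 1) := by
    rw [C, if_neg (by omega)]; congr 1; omega
  have h₂ : C (a + b + 1) ((a + 2 : ℕ) : ℤ) = (a + b + 1).choose (a + 2) := by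
    rw [C, if_neg (by omega)]; congr 1
  rw [show a + 2 + b + 1 - 2 = a + b + 1 by omega, h₀, h₁, h₂, adjacent_choose_ratio]
  push_cast
  congr 2 <;> ring

theorem ceil_natCast_div_two (n : ℕ) : ⌈(n : ℚ) / 2⌉ = (((n + 1) / 2 : ℕ) : ℤ) := by
  rw [Int.ceil_eq_iff]
  have h₁ : n ≤ 2 * ((n + 1) / 2) := by omega
  have h₂ : 2 * ((n + 1) / 2) ≤ n + 1 := by omega
  have h₁' : (n : ℚ) ≤ 2 * ((n + 1) / 2 : ℕ) := by exact_mod_cast h₁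
  have h₂' : 2 * (((n + 1) / 2 : ℕ) : ℚ) ≤ n + 1 := by exact_mod_cast h₂
  rw [Int.cast_natCast]
  constructor <;> linarith

theorem ratio_at_half {n : ℕ} (hn : 2 ≤ n) :
    (n : ℚ) * (n - 1) / (2 * ((n + 1) / 2 : ℕ) * (n - ((n + 1) / 2 : ℕ))) - 1
      = ((((n + 1) / 2 : ℕ) : ℚ) - 1) / ((n + 1) / 2 : ℕ) := by
  obtain ⟨c, rfl | rfl⟩ := Nat.even_or_odd' n
  · have hc : (c : ℚ) ≠ 0 := by norm_cast; omega
    rw [show (2 * c + 1) / 2 = c by omega]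
    push_cast
    rw [show (2 : ℚ) * c - c = c by ring]
    field_simp
    ring
  · have hc : (c : ℚ) ≠ 0 := by norm_cast; omega
    rw [show (2 * c + 1 + 1) / 2 = c + 1 by omega]
    push_cast
    rw [show (2 : ℚ) * c + 1 - (c + 1) = c by ring]
    field_simp
    ring

theorem mul_sub_le_half_mul_sub_half (n k : ℕ) :
    (k : ℚ) * (n - k) ≤ ((n + 1) / 2 : ℕ) * (n - ((n + 1) / 2 : ℕ)) := by
  suffices h : (k : ℤ) * (n - k) ≤ ((n + 1) / 2 : ℕ) * (n - ((n + 1) / 2 : ℕ)) by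
    have h' : (((k : ℤ) * (n - k) : ℤ) : ℚ) ≤
        (((((n + 1) / 2 : ℕ) : ℤ) * (n - ((n + 1) / 2 : ℕ)) : ℤ) : ℚ) := Int.cast_le.mpr h
    simpa only [Int.cast_mul, Int.cast_sub, Int.cast_natCast] using h'
  have key : 0 ≤ ((((n + 1) / 2 : ℕ) : ℤ) - k) * (n - ((n + 1) / 2 : ℕ) - k) := by
    rcases le_or_gt ((n + 1) / 2) k with h | h
    · exact mul_nonneg_of_nonpos_of_nonpos (by omega) (by omega)
    · exact mul_nonneg (by omega) (by omega)
  linarith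

theorem stmt_5 (n : ℕ) (hn : 4 ≤ n) :
    (Finset.Icc 2 (n - 2)).inf' (Finset.nonempty_Icc.mpr (by omega))
        (fun k => ((C (n - 2) ((k : ℤ) - 2) + C (n - 2) (k : ℤ) : ℕ) : ℚ) /
          ((2 * C (n - 2) ((k : ℤ) - 1) : ℕ) : ℚ))
      = ((⌈(n : ℚ) / 2⌉ : ℚ) - 1) / (⌈(n : ℚ) / 2⌉ : ℚ) := by
  rw [ceil_natCast_div_two, Int.cast_natCast, ← ratio_at_half (by omega)]
  apply le_antisymm
  · refine (Finset.inf'_le _ (b := (n + 1) / 2)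
      (Finset.mem_Icc.mpr ⟨by omega, by omega⟩)).trans_eq ?_
    exact C_ratio_eq (by omega) (by omega)
  · refine Finset.le_inf' _ _ fun k hk => ?_
    obtain ⟨hk₂, hkn⟩ := Finset.mem_Icc.mp hk
    rw [C_ratio_eq hk₂ (by omega)]
    have hn₁ : (1 : ℚ) ≤ n := by exact_mod_cast (by omega : 1 ≤ n)
    have hk₀ : (0 : ℚ) < k := by exact_mod_cast (by omega : 0 < k)
    have hkn' : (0 : ℚ) < n - k := by
      rw [sub_pos]; exact_mod_cast (by omega : k < n)
    have hmax := mul_sub_le_half_mul_sub_half n k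
    rw [mul_assoc 2, mul_assoc 2]
    gcongr
end

section
/- Let n ≥ 3, l := ⌊n/2⌋, and m := ⌈n/2⌉. Then, as rational numbers, 2*C(n−2, l−1) = C(n, l) * m / (2m − 1) and C(n−2, l−2) + C(n−2, l) = C(n, l) * (m − 1) / (2m − 1). Equivalently, L_l = C(n, l) * m/(2m−1) and R_l = C(n, l) * (m−1)/(2m−1). -/
/-- `R_k = C(n−2, k−2) + C(n−2, k)`. -/
def R (n k : ℕ) : ℕ := C (n - 2) ((k : ℤ) - 2) + C (n - 2) (k : ℤ)

/-- `L_k = 2·C(n−2, k−1)`. -/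
def L (n k : ℕ) : ℕ := 2 * C (n - 2) ((k : ℤ) - 1)

theorem choose_succ_mul_eq (a k : ℕ) (hk : k ≤ a) :
    ((a + 2).choose (k + 1) : ℚ) * (k + 1) * (a + 1 - k) = (a + 2) * (a + 1) * a.choose k := by
  have h₁ := Nat.add_one_mul_choose_eq (a + 1) k
  have h₂ := Nat.choose_mul_succ_eq a k
  zify [show k ≤ a + 1 by omega] at h₁ h₂
  have h₃ : ((a : ℚ) + 1 + 1) * (a + 1).choose k = (a + 2).choose (k + 1) * (k + 1) := by
    exact_mod_cast h₁
  have h₄ : (a.choose k : ℚ) * (a + 1) = (a + 1).choose k * (a + 1 - k) := by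
    exact_mod_cast h₂
  linear_combination -(a + 1 - k : ℚ) * h₃ - (a + 2 : ℚ) * h₄

theorem L_add_two_succ (a k : ℕ) : L (a + 2) (k + 1) = 2 * a.choose k := by
  simp [L, C]

theorem L_add_R (a k : ℕ) :
    L (a + 2) (k + 1) + R (a + 2) (k + 1) = (a + 2).choose (k + 1) := by
  rw [L_add_two_succ]
  rcases k with _ | k
  · simp [R, C]
    omega
  · have h₁ : ¬ ((k : ℤ) + 1 + 1 - 2 < 0) := by omega
    have h₂ : ((k : ℤ) + 1 + 1 - 2).toNat = k := by omega
    have h₃ : ¬ ((k : ℤ) + 1 + 1 < 0) := by omega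
    have h₄ : ((k : ℤ) + 1 + 1).toNat = k + 2 := by omega
    simp only [R, C, Nat.cast_add, Nat.cast_one, h₁, h₂, h₃, h₄, if_false, Nat.add_sub_cancel]
    simp only [Nat.choose_succ_succ' (a + 1), Nat.choose_succ_succ' a]
    ring

theorem ceil_half_eq (n : ℕ) : ⌈(n : ℚ) / 2⌉ = ((n - n / 2 : ℕ) : ℤ) := by
  rw [Int.ceil_eq_iff]
  have h₁ : n ≤ 2 * (n - n / 2) := by omega
  have h₂ : 2 * (n - n / 2) ≤ n + 1 := by omega
  have h₃ : (n : ℚ) ≤ 2 * (n - n / 2 : ℕ) := by exact_mod_cast h₁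
  have h₄ : 2 * ((n - n / 2 : ℕ) : ℚ) ≤ n + 1 := by exact_mod_cast h₂
  rw [Int.cast_natCast]
  constructor <;> linarith

theorem stmt_15 (n : ℕ) (hn : 3 ≤ n) (l : ℕ) (hl : l = n / 2)
    (m : ℤ) (hm : m = ⌈(n : ℚ) / 2⌉) :
    (L n l : ℚ) = (Nat.choose n l : ℚ) * (m : ℚ) / (2 * (m : ℚ) - 1) ∧
      (R n l : ℚ) = (Nat.choose n l : ℚ) * ((m : ℚ) - 1) / (2 * (m : ℚ) - 1) := by
  obtain ⟨a, rfl⟩ : ∃ a, n = a + 2 := ⟨n - 2, by omega⟩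
  obtain ⟨k, rfl⟩ : ∃ k, l = k + 1 := ⟨l - 1, by omega⟩
  obtain ⟨p, hp⟩ : ∃ p : ℕ, p + (k + 1) = a + 2 := ⟨a + 1 - k, by omega⟩
  have hmp : (m : ℚ) = p := by
    rw [hm, ceil_half_eq, ← hl, ← hp, Nat.add_sub_cancel, Int.cast_natCast]
  have hp₂ : (2 : ℚ) ≤ p := by exact_mod_cast (by omega : 2 ≤ p)
  have hpq : (p : ℚ) + (k + 1) = a + 2 := by exact_mod_cast hp
  have hD : 2 * (p : ℚ) - 1 ≠ 0 := by linarith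
  have hchoose := choose_succ_mul_eq a k (by omega)
  have hsum : (L (a + 2) (k + 1) : ℚ) + R (a + 2) (k + 1) = (a + 2).choose (k + 1) := by
    exact_mod_cast L_add_R a k
  have hL : (L (a + 2) (k + 1) : ℚ) * (2 * p - 1) = (a + 2).choose (k + 1) * p := by
    rw [L_add_two_succ]
    push_cast
    have hk : (k : ℚ) + 1 ≠ 0 := by positivity
    have hp₀ : (p : ℚ) ≠ 0 := by linarith
    have ha : (a : ℚ) = p + k - 1 := by linarith
    rcases (by omega : p = k + 1 ∨ p = k + 2) with h | h
    · have hkp : (k : ℚ) = p - 1 := by rw [h]; push_cast; ring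
      rw [ha, hkp] at hchoose
      apply mul_left_cancel₀ hp₀
      linear_combination -hchoose
    · have hkp : (k : ℚ) = p - 2 := by rw [h]; push_cast; ring
      rw [hkp] at hk
      rw [ha, hkp] at hchoose
      apply mul_left_cancel₀ hk
      linear_combination -hchoose
  rw [hmp, eq_div_iff hD, eq_div_iff hD]
  exact ⟨hL, by linear_combination (2 * (p : ℚ) - 1) * hsum - hL⟩
end
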